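/- arXiv:0904.2094 — 2 statements merged into one kernel-verified Lean document; each statement's English description precedes it below -/
import Mathlib

section
/- For every centered Gaussian sequence (G_n)_{n≥1} with unit variances (every finite real-linear combination of the G_n is centered Gaussian, E[G_n²] = 1), every n ≥ 2 and every t ∈ ℝ, setting Δ_n(t) = (1/log n) Σ_{k=1}^n (1/k)(e^{itG_k} − e^{−t²/2}), one has E[|Δ_n(t)|²] ≤ (t² e^{t²} / log² n) Σ_{k,l=1}^n |E[G_k G_l]| / (kl). -/
open MeasureTheory ProbabilityTheory Filter Topology

lemma aux_char {Ω : Type*} {mΩ : MeasurableSpace Ω} (μ : Measure Ω) [IsProbabilityMeasure μ]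
    (S : Ω → ℝ) (hS : Measurable S) (v : NNReal) (h : Measure.map S μ = gaussianReal 0 v) (t : ℝ) :
    MemLp S 2 μ ∧
    ∫ ω, Complex.exp (t * S ω * Complex.I) ∂μ
      = Complex.exp (-(t ^ 2 * (∫ ω, (S ω) ^ 2 ∂μ : ℝ) / 2 : ℝ)) := by
  have hm : MemLp S 2 μ := by
    have := memLp_id_gaussianReal (μ := 0) (v := v) 2
    rw [← h] at this
    exact (memLp_map_measure_iff (by fun_prop) hS.aemeasurable).1 this
  refine ⟨hm, ?_⟩
  have h1 : ∫ ω, (S ω) ^ 2 ∂μ = v := by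
    have h2 : ∫ x, x ^ 2 ∂(gaussianReal 0 v) = v := by
      have := variance_fun_id_gaussianReal (μ := 0) (v := v)
      rw [variance_of_integral_eq_zero (by fun_prop) (by simp)] at this
      simpa using this
    rw [← h, integral_map hS.aemeasurable (by fun_prop)] at h2
    exact h2
  have h3 := charFun_gaussianReal (μ := 0) (v := v) t
  rw [← h, charFun_apply_real, integral_map hS.aemeasurable (by fun_prop)] at h3
  rw [h1, h3]
  congr 1
  push_cast
  ring

lemma aux_exp (s r : ℝ) (hs : 0 ≤ s) (hr : |r| ≤ 1) :
    |Real.exp (s * r) - 1| ≤ s * Real.exp s * |r| := by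
  have a1 := Real.add_one_le_exp (s * r)
  have a2 := Real.add_one_le_exp (-(s * r))
  have a3 : Real.exp (s * r) * Real.exp (-(s * r)) = 1 := by rw [← Real.exp_add]; simp
  have a4 : Real.exp (s * r) ≤ Real.exp s := Real.exp_le_exp.2 (by nlinarith [le_abs_self r])
  have a5 : 1 ≤ Real.exp s := Real.one_le_exp hs
  have p := Real.exp_pos (s * r)
  have b1 : s * r ≤ s * |r| := mul_le_mul_of_nonneg_left (le_abs_self r) hs
  have b2 : -(s * r) ≤ s * |r| := by nlinarith [neg_abs_le r]
  have b0 : 0 ≤ s * |r| := by positivity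
  rw [abs_le]
  constructor
  · nlinarith
  · have : Real.exp (s * r) - 1 ≤ (s * r) * Real.exp (s * r) := by nlinarith
    nlinarith

lemma aux_cov {Ω : Type*} {mΩ : MeasurableSpace Ω} (μ : Measure Ω) [IsProbabilityMeasure μ]
    (G : ℕ → Ω → ℝ) (hGmeas : ∀ n, Measurable (G n))
    (hGauss : ∀ (s : Finset ℕ) (a : ℕ → ℝ), ∃ v : NNReal,
      Measure.map (fun ω => ∑ i ∈ s, a i * G i ω) μ = gaussianReal 0 v)
    (hvar : ∀ n, ∫ ω, (G n ω) ^ 2 ∂μ = 1) (t : ℝ) (k l : ℕ) :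
    ‖∫ ω, (Complex.exp (t * G k ω * Complex.I) - Complex.exp (-t ^ 2 / 2)) *
      (starRingEnd ℂ) (Complex.exp (t * G l ω * Complex.I) - Complex.exp (-t ^ 2 / 2)) ∂μ‖
      ≤ t ^ 2 * Real.exp (t ^ 2) * |∫ ω, G k ω * G l ω ∂μ| := by
  have hone : ∀ k, ∃ v : NNReal, Measure.map (G k) μ = gaussianReal 0 v := by
    intro k
    simpa using hGauss {k} (fun _ => 1)
  have hL : ∀ k, MemLp (G k) 2 μ := fun k => by
    obtain ⟨v, hv⟩ := hone k
    exact (aux_char μ _ (hGmeas k) v hv 0).1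
  have hc : ∀ k (t : ℝ), ∫ ω, Complex.exp (t * G k ω * Complex.I) ∂μ
      = Complex.exp (-t ^ 2 / 2) := fun k t => by
    obtain ⟨v, hv⟩ := hone k
    rw [(aux_char μ _ (hGmeas k) v hv t).2, hvar]
    congr 1
    push_cast
    ring
  have hdiff : ∃ v : NNReal, Measure.map (fun ω => G k ω - G l ω) μ = gaussianReal 0 v := by
    by_cases hkl : k = l
    · subst hkl
      simpa using hGauss ∅ (fun _ => 1)
    · obtain ⟨v, hv⟩ := hGauss {k, l} (fun i => if i = k then 1 else -1)
      refine ⟨v, ?_⟩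
      rw [← hv]
      congr 1
      ext ω
      rw [Finset.sum_pair hkl]
      simp [Ne.symm hkl, sub_eq_add_neg]
  have hi : ∀ k, Integrable (fun ω => G k ω ^ 2) μ := fun k => (hL k).integrable_sq
  have hkl : Integrable (fun ω => G k ω * G l ω) μ := (hL k).integrable_mul (hL l)
  set r := ∫ ω, G k ω * G l ω ∂μ with hr
  have hr1 : |r| ≤ 1 := by
    calc |r| ≤ ∫ ω, |G k ω * G l ω| ∂μ := abs_integral_le_integral_abs
      _ ≤ ∫ ω, (G k ω ^ 2 + G l ω ^ 2) / 2 ∂μ := by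
        refine integral_mono hkl.abs (((hi k).add (hi l)).div_const 2) fun ω => ?_
        simp only
        rw [abs_mul, ← sq_abs (G k ω), ← sq_abs (G l ω)]
        nlinarith [sq_nonneg (|G k ω| - |G l ω|)]
      _ = 1 := by
        rw [integral_div, integral_add (hi k) (hi l), hvar, hvar]; norm_num
  have hv2 : ∫ ω, (G k ω - G l ω) ^ 2 ∂μ = 2 - 2 * r := by
    have : ∀ ω, (G k ω - G l ω) ^ 2 = (G k ω ^ 2 + G l ω ^ 2) - 2 * (G k ω * G l ω) := fun ω => by ring
    simp_rw [this]
    have hadd : Integrable (fun ω => G k ω ^ 2 + G l ω ^ 2) μ := (hi k).add (hi l)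
    rw [integral_sub hadd (hkl.const_mul 2), integral_add (hi k) (hi l), hvar, hvar,
      integral_const_mul]
    ring
  have hd : ∫ ω, Complex.exp (t * (G k ω - G l ω : ℝ) * Complex.I) ∂μ
      = Complex.exp (-(t ^ 2 * (2 - 2 * r) / 2 : ℝ)) := by
    obtain ⟨v, hv⟩ := hdiff
    rw [(aux_char μ (fun ω => G k ω - G l ω) ((hGmeas k).sub (hGmeas l)) v hv t).2, hv2]
  have hint : ∀ (f : Ω → ℝ), Measurable f → ∀ t : ℝ,
      Integrable (fun ω => Complex.exp (t * f ω * Complex.I)) μ := by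
    intro f hf t
    refine Integrable.of_bound (C := 1) (by fun_prop) (ae_of_all _ fun ω => ?_)
    rw [← Complex.ofReal_mul, Complex.norm_exp_ofReal_mul_I]
  have hmain : ∫ ω, (Complex.exp (t * G k ω * Complex.I) - Complex.exp (-t ^ 2 / 2)) *
      (starRingEnd ℂ) (Complex.exp (t * G l ω * Complex.I) - Complex.exp (-t ^ 2 / 2)) ∂μ
      = ((Real.exp (-t ^ 2) * (Real.exp (t ^ 2 * r) - 1) : ℝ) : ℂ) := by
    have e : ∀ ω, (Complex.exp (t * G k ω * Complex.I) - Complex.exp (-t ^ 2 / 2)) *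
      (starRingEnd ℂ) (Complex.exp (t * G l ω * Complex.I) - Complex.exp (-t ^ 2 / 2))
      = (Complex.exp (t * (G k ω - G l ω : ℝ) * Complex.I)
        - Complex.exp (t * G k ω * Complex.I) * Complex.exp (-t ^ 2 / 2))
        - (Complex.exp ((-t : ℝ) * G l ω * Complex.I) * Complex.exp (-t ^ 2 / 2)
          - Complex.exp (-t ^ 2 / 2) * Complex.exp (-t ^ 2 / 2)) := by
      intro ω
      have e1 : Complex.exp (t * (G k ω - G l ω : ℝ) * Complex.I)
        = Complex.exp (t * G k ω * Complex.I) * Complex.exp ((-t : ℝ) * G l ω * Complex.I) := by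
        rw [← Complex.exp_add]; congr 1; push_cast; ring
      have e2 : (starRingEnd ℂ) (Complex.exp (t * G l ω * Complex.I))
          = Complex.exp ((-t : ℝ) * G l ω * Complex.I) := by
        rw [← Complex.exp_conj]; congr 1; simp
      have e3 : (starRingEnd ℂ) (Complex.exp (-t ^ 2 / 2)) = Complex.exp (-t ^ 2 / 2) := by
        rw [← Complex.exp_conj]; congr 1
        rw [show (-(t : ℂ) ^ 2 / 2) = ((-t ^ 2 / 2 : ℝ) : ℂ) by push_cast; ring,
          Complex.conj_ofReal]
      rw [map_sub, e1, e2, e3]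
      ring
    simp_rw [e]
    have i1 := hint (fun ω => G k ω - G l ω) ((hGmeas k).sub (hGmeas l)) t
    have i2 := (hint _ (hGmeas k) t).mul_const (Complex.exp (-t ^ 2 / 2))
    have i3 := (hint _ (hGmeas l) (-t)).mul_const (Complex.exp (-t ^ 2 / 2))
    have i4 : Integrable (fun _ : Ω => Complex.exp (-(t : ℂ) ^ 2 / 2) *
      Complex.exp (-(t : ℂ) ^ 2 / 2)) μ := integrable_const _
    have i12 := i1.sub i2
    have i34 := i3.sub i4
    simp only [Pi.sub_def] at i12 i34
    rw [integral_sub i12 i34, integral_sub i1 i2, integral_sub i3 i4, integral_mul_const, integral_mul_const, hc, hc, hd]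
    simp only [integral_const, probReal_univ, one_smul]
    have q1 : Complex.exp (-((t ^ 2 * (2 - 2 * r) / 2 : ℝ) : ℂ))
        = Complex.exp (-(t : ℂ) ^ 2) * Complex.exp ((t : ℂ) ^ 2 * r) := by
      rw [← Complex.exp_add]; congr 1; push_cast; ring
    have q2 : Complex.exp (-(t : ℂ) ^ 2 / 2) * Complex.exp (-(t : ℂ) ^ 2 / 2)
        = Complex.exp (-(t : ℂ) ^ 2) := by
      rw [← Complex.exp_add]; congr 1; ring
    have q3 : (((-t : ℝ) : ℂ)) ^ 2 = (t : ℂ) ^ 2 := by push_cast; ring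
    rw [q1, q3, q2]
    push_cast
    ring
  rw [hmain, Complex.norm_real, Real.norm_eq_abs, abs_mul, abs_of_pos (Real.exp_pos _)]
  have h1 : Real.exp (-t ^ 2) ≤ 1 := Real.exp_le_one_iff.2 (by nlinarith [sq_nonneg t])
  calc _ ≤ 1 * |Real.exp (t ^ 2 * r) - 1| := by gcongr
    _ ≤ _ := by rw [one_mul]; exact aux_exp _ _ (sq_nonneg t) hr1



/-- For a centered Gaussian sequence with unit variances, for every `n ≥ 2` and `t ∈ ℝ`,
with `Δ_n(t) = (1/log n) Σ_{k=1}^n (1/k)(e^{itG_k} − e^{−t²/2})`, one has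
`E[|Δ_n(t)|²] ≤ (t² e^{t²} / log² n) Σ_{k,l=1}^n |E[G_k G_l]|/(kl)`. -/
theorem stmt3
    {Ω : Type*} {mΩ : MeasurableSpace Ω} (μ : Measure Ω) [IsProbabilityMeasure μ]
    (G : ℕ → Ω → ℝ) (hGmeas : ∀ n, Measurable (G n))
    -- every finite real-linear combination of the `G_n` is centered Gaussian
    (hGauss : ∀ (s : Finset ℕ) (a : ℕ → ℝ), ∃ v : NNReal,
      Measure.map (fun ω => ∑ i ∈ s, a i * G i ω) μ = gaussianReal 0 v)
    (hvar : ∀ n, ∫ ω, (G n ω) ^ 2 ∂μ = 1)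
    (Δ : ℕ → ℝ → Ω → ℂ)
    (hΔ : ∀ n t ω, Δ n t ω = (Real.log n)⁻¹ •
      ∑ k ∈ Finset.Icc 1 n, (k : ℂ)⁻¹ *
        (Complex.exp (t * G k ω * Complex.I) - Complex.exp (-t ^ 2 / 2)))
    (n : ℕ) (hn : 2 ≤ n) (t : ℝ) :
    ∫ ω, ‖Δ n t ω‖ ^ 2 ∂μ
      ≤ (t ^ 2 * Real.exp (t ^ 2) / (Real.log n) ^ 2) *
        ∑ k ∈ Finset.Icc 1 n, ∑ l ∈ Finset.Icc 1 n,
          |∫ ω, G k ω * G l ω ∂μ| / ((k : ℝ) * (l : ℝ)) := by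


  set X : ℕ → Ω → ℂ := fun k ω =>
    Complex.exp (t * G k ω * Complex.I) - Complex.exp (-t ^ 2 / 2) with hX
  have hXm : ∀ k, Measurable (X k) := fun k => by
    have := hGmeas k
    simp only [hX]
    fun_prop
  have hXb : ∀ k ω, ‖X k ω‖ ≤ 1 + ‖Complex.exp (-(t : ℂ) ^ 2 / 2)‖ := by
    intro k ω
    refine (norm_sub_le _ _).trans ?_
    rw [← Complex.ofReal_mul, Complex.norm_exp_ofReal_mul_I]
  have hXi : ∀ k l, Integrable (fun ω => X k ω * (starRingEnd ℂ) (X l ω)) μ := by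
    intro k l
    have m1 := hXm k
    have m2 : Measurable fun ω => (starRingEnd ℂ) (X l ω) :=
      Complex.continuous_conj.measurable.comp (hXm l)
    refine Integrable.of_bound (C := (1 + ‖Complex.exp (-(t : ℂ) ^ 2 / 2)‖) *
      (1 + ‖Complex.exp (-(t : ℂ) ^ 2 / 2)‖)) (m1.mul m2).aestronglyMeasurable
      (ae_of_all _ fun ω => ?_)
    rw [norm_mul, RCLike.norm_conj]
    exact mul_le_mul (hXb k ω) (hXb l ω) (norm_nonneg _) (by positivity)
  have hpt : ∀ ω, ((‖Δ n t ω‖ ^ 2 : ℝ) : ℂ) = ∑ k ∈ Finset.Icc 1 n, ∑ l ∈ Finset.Icc 1 n,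
      (((Real.log n) ^ 2)⁻¹ * ((k : ℝ) * l)⁻¹ : ℝ) * (X k ω * (starRingEnd ℂ) (X l ω)) := by
    intro ω
    push_cast
    rw [← Complex.mul_conj', hΔ, Complex.real_smul, map_mul, map_sum, Complex.conj_ofReal,
      mul_mul_mul_comm, Finset.sum_mul_sum, Finset.mul_sum]
    refine Finset.sum_congr rfl fun k _ => ?_
    rw [Finset.mul_sum]
    refine Finset.sum_congr rfl fun l _ => ?_
    simp only [map_mul, map_inv₀, Complex.conj_natCast, hX, mul_inv]
    push_cast
    ring
  have hI : ((∫ ω, ‖Δ n t ω‖ ^ 2 ∂μ : ℝ) : ℂ) = ∑ k ∈ Finset.Icc 1 n, ∑ l ∈ Finset.Icc 1 n,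
      (((Real.log n) ^ 2)⁻¹ * ((k : ℝ) * l)⁻¹ : ℝ) *
        ∫ ω, X k ω * (starRingEnd ℂ) (X l ω) ∂μ := by
    rw [← integral_complex_ofReal]
    simp_rw [hpt]
    rw [integral_finsetSum _ fun k _ => integrable_finsetSum _ fun l _ => (hXi k l).const_mul _]
    refine Finset.sum_congr rfl fun k _ => ?_
    rw [integral_finsetSum _ fun l _ => (hXi k l).const_mul _]
    exact Finset.sum_congr rfl fun l _ => integral_const_mul _ _
  calc ∫ ω, ‖Δ n t ω‖ ^ 2 ∂μ ≤ ‖((∫ ω, ‖Δ n t ω‖ ^ 2 ∂μ : ℝ) : ℂ)‖ := by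
        rw [Complex.norm_real]; exact Real.le_norm_self _
    _ ≤ ∑ k ∈ Finset.Icc 1 n, ∑ l ∈ Finset.Icc 1 n,
        (((Real.log n) ^ 2)⁻¹ * ((k : ℝ) * l)⁻¹) *
          (t ^ 2 * Real.exp (t ^ 2) * |∫ ω, G k ω * G l ω ∂μ|) := by
        rw [hI]
        refine norm_sum_le_of_le _ fun k _ => norm_sum_le_of_le _ fun l _ => ?_
        rw [norm_mul, Complex.norm_real, Real.norm_of_nonneg (by positivity)]
        exact mul_le_mul_of_nonneg_left (aux_cov μ G hGmeas hGauss hvar t k l) (by positivity)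
    _ = _ := by
        rw [Finset.mul_sum]
        refine Finset.sum_congr rfl fun k _ => ?_
        rw [Finset.mul_sum]
        refine Finset.sum_congr rfl fun l _ => ?_
        rw [div_eq_mul_inv, div_eq_mul_inv]
        ring
end

section
/- Let H ∈ (0,1) and let (B_k)_{k∈ℕ} be a discrete fractional Brownian motion with Hurst index H. Then the sequence G_k = B_k / k^H (k ≥ 1) satisfies the ASCLT: almost surely, for every bounded continuous φ : ℝ → ℝ, (1/log n) Σ_{k=1}^n (1/k) φ(B_k / k^H) → E[φ(N)] as n → ∞, where N is a standard Gaussian random variable. -/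
open MeasureTheory ProbabilityTheory Filter Topology

open scoped RealInnerProductSpace in
/-- Tightness from a.e. convergence of characteristic functions. -/
lemma aslt_tight {μ : ℕ → Measure ℝ} [∀ i, IsProbabilityMeasure (μ i)]
    {f : ℝ → ℂ} (hf : ContinuousAt f 0) (hf_meas : Measurable f) (hf0 : f 0 = 1)
    (h : ∀ᵐ t : ℝ, Tendsto (fun n ↦ charFun (μ n) t) atTop (𝓝 (f t))) :
    IsTightMeasureSet (Set.range μ) := by
  refine isTightMeasureSet_range_of_tendsto_limsup_measureReal_inner_of_norm_eq_one ℝ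
    (fun z hz ↦ ?_) 1 (.of_forall fun _ ↦ by simp)
  have hae : ∀ᵐ t : ℝ, Tendsto (fun n ↦ charFun (μ n) (t • z)) atTop (𝓝 (f (t • z))) := by
    rcases (abs_eq (zero_le_one' ℝ)).1 (by simpa using hz) with rfl | rfl
    · simpa using h
    · have := (Measure.measurePreserving_neg (volume : Measure ℝ)).quasiMeasurePreserving.ae h
      simpa using this
  have h_le_4 n r (hr : 0 < r) :
      2⁻¹ * r * ‖∫ t in -2 * r⁻¹..2 * r⁻¹, 1 - charFun (μ n) (t • z)‖ ≤ 4 := by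
    have hr' : -(2 * r⁻¹) ≤ 2 * r⁻¹ := by rw [neg_le_self_iff]; positivity
    calc 2⁻¹ * r * ‖∫ t in -2 * r⁻¹..2 * r⁻¹, 1 - charFun (μ n) (t • z)‖
    _ ≤ 2⁻¹ * r * ∫ t in -(2 * r⁻¹)..2 * r⁻¹, ‖1 - charFun (μ n) (t • z)‖ := by
      grw [neg_mul, intervalIntegral.norm_integral_le_integral_norm hr']
    _ ≤ 2⁻¹ * r * ∫ t in -(2 * r⁻¹)..2 * r⁻¹, 2 := by
      gcongr
      rw [intervalIntegral.integral_of_le hr', intervalIntegral.integral_of_le hr']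
      refine integral_mono_of_nonneg ?_ (by fun_prop) ?_
      · exact ae_of_all _ fun _ ↦ by positivity
      · exact ae_of_all _ fun _ ↦ norm_one_sub_charFun_le_two
    _ ≤ 4 := by
      simp only [intervalIntegral.integral_const, sub_neg_eq_add, smul_eq_mul]
      field_simp
      norm_num
  have h_le n r (hr : 0 < r) : (μ n).real {x | r < |⟪z, x⟫|} ≤
      2⁻¹ * r * ‖∫ t in -2 * r⁻¹..2 * r⁻¹, 1 - charFun (μ n) (t • z)‖ :=
    measureReal_abs_inner_gt_le_integral_charFun hr
  have h_limsup_le r (hr : 0 < r) :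
      limsup (fun n ↦ (μ n).real {x | r < |⟪z, x⟫|}) atTop
        ≤ 2⁻¹ * r * ‖∫ t in -2 * r⁻¹..2 * r⁻¹, 1 - f (t • z)‖ := by
    calc limsup (fun n ↦ (μ n).real {x | r < |⟪z, x⟫|}) atTop
    _ ≤ limsup (fun n ↦ 2⁻¹ * r
        * ‖∫ t in -2 * r⁻¹..2 * r⁻¹, 1 - charFun (μ n) (t • z)‖) atTop := by
      refine limsup_le_limsup (.of_forall fun n ↦ h_le n r hr) ?_ ?_
      · exact IsCoboundedUnder.of_frequently_ge <| .of_forall fun _ ↦ ENNReal.toReal_nonneg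
      · refine ⟨4, ?_⟩
        simp only [eventually_map, eventually_atTop]
        exact ⟨0, fun n _ ↦ h_le_4 n r hr⟩
    _ = 2⁻¹ * r * ‖∫ t in -2 * r⁻¹..2 * r⁻¹, 1 - f (t • z)‖ := by
      refine ((Tendsto.norm ?_).const_mul _).limsup_eq
      simp only [neg_mul]
      have hr' : -(2 * r⁻¹) ≤ 2 * r⁻¹ := by rw [neg_le_self_iff]; positivity
      simp_rw [intervalIntegral.integral_of_le hr']
      refine tendsto_integral_of_dominated_convergence (fun _ ↦ 2) ?_ (by fun_prop) ?_ ?_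
      · exact fun _ ↦ Measurable.aestronglyMeasurable <| by fun_prop
      · exact fun _ ↦ ae_of_all _ fun _ ↦ norm_one_sub_charFun_le_two
      · filter_upwards [ae_restrict_of_ae hae] with t ht using tendsto_const_nhds.sub ht
  refine tendsto_of_tendsto_of_tendsto_of_le_of_le' tendsto_const_nhds
    (h := fun r ↦ 2⁻¹ * r * ‖∫ t in -2 * r⁻¹..2 * r⁻¹, 1 - f (t • z)‖) ?_ ?_ ?_
  rotate_left
  · filter_upwards [eventually_gt_atTop 0] with r hr
    refine le_limsup_of_le ?_ fun u hu ↦ ?_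
    · refine ⟨4, ?_⟩
      simp only [eventually_map, eventually_atTop]
      exact ⟨0, fun n _ ↦ (h_le n r hr).trans (h_le_4 n r hr)⟩
    · exact ENNReal.toReal_nonneg.trans hu.exists.choose_spec
  · filter_upwards [eventually_gt_atTop 0] with r hr using h_limsup_le r hr
  have hf_tendsto := hf.tendsto
  rw [Metric.tendsto_nhds_nhds] at hf_tendsto
  rw [Metric.tendsto_atTop]
  intro ε hε
  simp only [gt_iff_lt, dist_eq_norm_sub', zero_sub, norm_neg, hf0] at hf_tendsto
  simp only [ge_iff_le, neg_mul, dist_zero_right, norm_mul, norm_inv,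
    Real.norm_ofNat, Real.norm_eq_abs, abs_of_nonneg (norm_nonneg _)]
  obtain ⟨δ, hδ, hδ_lt⟩ : ∃ δ, 0 < δ ∧ ∀ ⦃x : ℝ⦄, ‖x‖ < δ → ‖1 - f x‖ < ε / 4 :=
    hf_tendsto (ε / 4) (by positivity)
  refine ⟨4 * δ⁻¹, fun r hrδ ↦ ?_⟩
  have hr : 0 < r := lt_of_lt_of_le (by positivity) hrδ
  have hr' : -(2 * r⁻¹) ≤ 2 * r⁻¹ := by rw [neg_le_self_iff]; positivity
  have h_le_Ioc x (hx : x ∈ Set.Ioc (-(2 * r⁻¹)) (2 * r⁻¹)) : ‖1 - f (x • z)‖ ≤ ε / 4 := by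
    refine (hδ_lt ?_).le
    rw [norm_smul, hz, mul_one, Real.norm_eq_abs]
    calc |x|
    _ ≤ 2 * r⁻¹ := by grind
    _ < δ := by
      rw [← lt_div_iff₀' (by positivity), inv_lt_comm₀ hr (by positivity)]
      refine lt_of_lt_of_le ?_ hrδ
      field_simp
      norm_num
  rw [abs_of_nonneg hr.le]
  calc 2⁻¹ * r * ‖∫ t in -(2 * r⁻¹)..2 * r⁻¹, 1 - f (t • z)‖
  _ ≤ 2⁻¹ * r * ∫ t in -(2 * r⁻¹)..2 * r⁻¹, ‖1 - f (t • z)‖ := by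
    grw [intervalIntegral.norm_integral_le_integral_norm hr']
  _ ≤ 2⁻¹ * r * ∫ t in -(2 * r⁻¹)..2 * r⁻¹, ε / 4 := by
    gcongr
    rw [intervalIntegral.integral_of_le hr', intervalIntegral.integral_of_le hr']
    refine integral_mono_ae ?_ (by fun_prop) ?_
    · refine Integrable.mono' (integrable_const (ε / 4)) ?_ ?_
      · exact Measurable.aestronglyMeasurable <| by fun_prop
      · simpa using ae_restrict_of_forall_mem measurableSet_Ioc h_le_Ioc
    · exact ae_restrict_of_forall_mem measurableSet_Ioc h_le_Ioc
  _ = ε / 2 := by simp; field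
  _ < ε := by simp [hε]

/-- Lévy's theorem with a.e. convergence of characteristic functions. -/
lemma aslt_levy {μ : ℕ → ProbabilityMeasure ℝ} {μ₀ : ProbabilityMeasure ℝ}
    (h : ∀ᵐ t : ℝ, Tendsto (fun n ↦ charFun (μ n : Measure ℝ) t) atTop
      (𝓝 (charFun (μ₀ : Measure ℝ) t))) :
    Tendsto μ atTop (𝓝 μ₀) := by
  have hc : ∀ ν : ProbabilityMeasure ℝ, Continuous (charFun (ν : Measure ℝ)) := fun ν => by fun_prop
  have h_tight : IsTightMeasureSet (Set.range fun n => (μ n : Measure ℝ)) :=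
    aslt_tight (hc μ₀).continuousAt (hc μ₀).measurable (by simp) h
  refine (Filter.tendsto_iff_ultrafilter _ _ _).2 fun U hU ↦ ?_
  have h_compact : IsCompact (closure {μ n | n}) :=
    isCompact_closure_of_isTightMeasureSet (by
      convert h_tight using 1
      ext ν
      simp [Set.range])
  obtain ⟨μ', -, hμ' : Tendsto _ _ _⟩ := h_compact.ultrafilter_le_nhds (U.map μ)
    (.trans (by simp) (monotone_principal subset_closure))
  suffices (μ' : Measure ℝ) = μ₀ by convert! hμ'; ext; rw [this]
  refine Measure.ext_of_charFun ?_
  refine ((hc μ').ae_eq_iff_eq (volume : Measure ℝ) (hc μ₀)).1 ?_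
  filter_upwards [h] with t ht
  refine tendsto_nhds_unique ?_ (ht.comp hU)
  have hμ'' := (ProbabilityMeasure.tendsto_iff_forall_integral_rclike_tendsto ℂ).1 hμ'
  simp_rw [charFun_eq_integral_innerProbChar]
  exact hμ'' (BoundedContinuousFunction.innerProbChar t)

/-- harmonic sums -/
noncomputable def asW (n : ℕ) : ℝ := ∑ k ∈ Finset.Icc 1 n, (k : ℝ)⁻¹

lemma asW_succ (n : ℕ) : asW (n + 1) = asW n + ((n + 1 : ℕ) : ℝ)⁻¹ := by
  unfold asW; rw [Finset.sum_Icc_succ_top (by omega)]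

lemma asW_mono : Monotone asW := monotone_nat_of_le_succ fun n => by
  rw [asW_succ]; have : (0 : ℝ) ≤ ((n + 1 : ℕ) : ℝ)⁻¹ := by positivity
  linarith

lemma asW_eq_harmonic (n : ℕ) : asW n = (harmonic n : ℝ) := by
  rw [harmonic_eq_sum_Icc]; simp [asW]

lemma asW_pos {n : ℕ} (hn : 1 ≤ n) : 0 < asW n := by
  have := asW_mono hn
  have h1 : asW 1 = 1 := by simp [asW]
  linarith

lemma asW_tendsto : Tendsto asW atTop atTop := by
  have h := Real.tendsto_harmonic_sub_log
  have h2 : Tendsto (fun n : ℕ => Real.log n) atTop atTop :=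
    Real.tendsto_log_atTop.comp tendsto_natCast_atTop_atTop
  have := h.add_atTop h2
  refine this.congr fun n => ?_
  rw [asW_eq_harmonic]; ring

lemma asW_div_log : Tendsto (fun n : ℕ => (Real.log n)⁻¹ * asW n) atTop (𝓝 1) := by
  have h := Real.tendsto_harmonic_sub_log
  have h2 : Tendsto (fun n : ℕ => Real.log n) atTop atTop :=
    Real.tendsto_log_atTop.comp tendsto_natCast_atTop_atTop
  have h3 := (h2.inv_tendsto_atTop.mul h).add_const 1
  simp only [zero_mul, zero_add] at h3
  refine h3.congr' ?_
  filter_upwards [h2.eventually_gt_atTop 0] with n hn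
  simp only [Pi.inv_apply]
  rw [asW_eq_harmonic]
  field_simp
  ring

lemma as_pow_sum {α : ℝ} (h0 : 0 < α) (h1 : α ≤ 1) (l : ℕ) :
    ∑ k ∈ Finset.Icc 1 l, (k : ℝ)⁻¹ * (k : ℝ) ^ α ≤ (l : ℝ) ^ α / α := by
  induction l with
  | zero => simp [Real.zero_rpow h0.ne']
  | succ n ih =>
    rw [Finset.sum_Icc_succ_top (by omega)]
    have hp : (0 : ℝ) < ((n + 1 : ℕ) : ℝ) := by positivity
    have hk : (1 : ℝ) ≤ ((n + 1 : ℕ) : ℝ) := by push_cast; linarith [n.cast_nonneg (α := ℝ)]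
    have hb := rpow_one_add_le_one_add_mul_self (s := -((n + 1 : ℕ) : ℝ)⁻¹)
      (by have := inv_le_one_of_one_le₀ hk; linarith) h0.le h1
    have he : (n : ℝ) ^ α = ((n + 1 : ℕ) : ℝ) ^ α * (1 + -((n + 1 : ℕ) : ℝ)⁻¹) ^ α := by
      rw [← Real.mul_rpow hp.le (by have := inv_le_one_of_one_le₀ hk; linarith)]
      congr 1
      push_cast at hp ⊢
      field_simp
      ring
    have h3 : (n : ℝ) ^ α ≤ ((n + 1 : ℕ) : ℝ) ^ α * (1 + α * -((n + 1 : ℕ) : ℝ)⁻¹) := by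
      rw [he]; gcongr
    have h4 : (n : ℝ) ^ α / α ≤ ((n + 1 : ℕ) : ℝ) ^ α * (1 + α * -((n + 1 : ℕ) : ℝ)⁻¹) / α := by
      gcongr
    refine (add_le_add_left (ih.trans h4) _).trans (le_of_eq ?_)
    field_simp
    ring

section slln
variable {Ω : Type*} {mΩ : MeasurableSpace Ω} (μ : Measure Ω) [IsProbabilityMeasure μ]

lemma as_second_moment (Y : ℕ → Ω → ℂ) (hm : ∀ k, Measurable (Y k)) (hb : ∀ k ω, ‖Y k ω‖ ≤ 2)
    {C α : ℝ} (hC : 0 ≤ C) (h0 : 0 < α) (h1 : α ≤ 1)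
    (hcov : ∀ k l : ℕ, 1 ≤ k → k ≤ l → ∫ ω, inner ℝ (Y k ω) (Y l ω) ∂μ ≤ C * ((k : ℝ) / l) ^ α)
    (n : ℕ) :
    ∫ ω, ‖∑ k ∈ Finset.Icc 1 n, (k : ℝ)⁻¹ • Y k ω‖ ^ 2 ∂μ ≤ 2 * C / α * asW n := by
  have hint : ∀ k l, Integrable (fun ω => inner ℝ (Y k ω) (Y l ω)) μ := fun k l => by
    refine Integrable.of_bound (C := 4) ((hm k).inner (hm l)).aestronglyMeasurable
      (ae_of_all _ fun ω => ?_)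
    refine (norm_inner_le_norm _ _).trans ?_
    nlinarith [hb k ω, hb l ω, norm_nonneg (Y k ω), norm_nonneg (Y l ω)]
  have e1 : ∀ ω, ‖∑ k ∈ Finset.Icc 1 n, (k : ℝ)⁻¹ • Y k ω‖ ^ 2 =
      ∑ k ∈ Finset.Icc 1 n, ∑ l ∈ Finset.Icc 1 n,
        ((k : ℝ)⁻¹ * (l : ℝ)⁻¹) * inner ℝ (Y k ω) (Y l ω) := fun ω => by
    rw [← real_inner_self_eq_norm_sq, sum_inner]
    refine Finset.sum_congr rfl fun k _ => ?_
    rw [inner_sum]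
    refine Finset.sum_congr rfl fun l _ => ?_
    rw [real_inner_smul_left, real_inner_smul_right, mul_assoc]
  simp_rw [e1]
  rw [integral_finsetSum _ fun k _ => integrable_finsetSum _ fun l _ => (hint k l).const_mul _]
  simp_rw [integral_finsetSum _ fun l _ => (hint _ l).const_mul _, integral_const_mul]
  set a : ℕ → ℕ → ℝ := fun k l =>
    if k ≤ l then ((k : ℝ)⁻¹ * (l : ℝ)⁻¹) * (C * ((k : ℝ) / l) ^ α) else 0 with ha
  have ha0 : ∀ k l, 0 ≤ a k l := fun k l => by
    simp only [ha]; split_ifs <;> positivity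
  have hcol : ∀ l ∈ Finset.Icc 1 n, ∑ k ∈ Finset.Icc 1 n, a k l ≤ C / α * (l : ℝ)⁻¹ := by
    intro l hl
    rw [Finset.mem_Icc] at hl
    have hlp : (0 : ℝ) < l := by exact_mod_cast hl.1
    have e2 : ∑ k ∈ Finset.Icc 1 n, a k l = ∑ k ∈ Finset.Icc 1 l,
        (C * (l : ℝ)⁻¹ * ((l : ℝ) ^ α)⁻¹) * ((k : ℝ)⁻¹ * (k : ℝ) ^ α) := by
      simp only [ha]
      rw [← Finset.sum_filter]
      refine Finset.sum_congr ?_ fun k hk => ?_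
      · ext k; simp only [Finset.mem_filter, Finset.mem_Icc]; omega
      · rw [Real.div_rpow (by positivity) (by positivity)]; ring
    rw [e2, ← Finset.mul_sum]
    have hlα : 0 < (l : ℝ) ^ α := by positivity
    calc _ ≤ (C * (l : ℝ)⁻¹ * ((l : ℝ) ^ α)⁻¹) * ((l : ℝ) ^ α / α) := by
          gcongr; exact as_pow_sum h0 h1 l
      _ = _ := by field_simp
  calc _ ≤ ∑ k ∈ Finset.Icc 1 n, ∑ l ∈ Finset.Icc 1 n, (a k l + a l k) := by
        refine Finset.sum_le_sum fun k hk => Finset.sum_le_sum fun l hl => ?_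
        rw [Finset.mem_Icc] at hk hl
        rcases le_total k l with h | h
        · have h5 : a k l = ((k : ℝ)⁻¹ * (l : ℝ)⁻¹) * (C * ((k : ℝ) / l) ^ α) := by simp [ha, h]
          have h6 := mul_le_mul_of_nonneg_left (hcov k l hk.1 h)
            (by positivity : (0 : ℝ) ≤ (k : ℝ)⁻¹ * (l : ℝ)⁻¹)
          linarith [ha0 l k]
        · have h5 : a l k = ((l : ℝ)⁻¹ * (k : ℝ)⁻¹) * (C * ((l : ℝ) / k) ^ α) := by simp [ha, h]
          have h6 := mul_le_mul_of_nonneg_left (hcov l k hl.1 h)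
            (by positivity : (0 : ℝ) ≤ (l : ℝ)⁻¹ * (k : ℝ)⁻¹)
          have h7 : ∫ ω, inner ℝ (Y k ω) (Y l ω) ∂μ = ∫ ω, inner ℝ (Y l ω) (Y k ω) ∂μ := by
            congr with ω
            rw [real_inner_comm]
          rw [mul_comm (k : ℝ)⁻¹, h7]
          linarith [ha0 k l]
    _ = ∑ l ∈ Finset.Icc 1 n, ∑ k ∈ Finset.Icc 1 n, a k l +
        ∑ l ∈ Finset.Icc 1 n, ∑ k ∈ Finset.Icc 1 n, a k l := by
        simp_rw [Finset.sum_add_distrib]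
        rw [Finset.sum_comm]
    _ ≤ ∑ l ∈ Finset.Icc 1 n, C / α * (l : ℝ)⁻¹ + ∑ l ∈ Finset.Icc 1 n, C / α * (l : ℝ)⁻¹ :=
        add_le_add (Finset.sum_le_sum hcol) (Finset.sum_le_sum hcol)
    _ = _ := by rw [← Finset.mul_sum]; unfold asW; ring

lemma as_exists (j : ℕ) : ∃ n, ((j : ℝ) + 1) ^ 2 ≤ asW n :=
  (asW_tendsto.eventually_ge_atTop _).exists

lemma as_slln (Y : ℕ → Ω → ℂ) (hm : ∀ k, Measurable (Y k)) (hb : ∀ k ω, ‖Y k ω‖ ≤ 2)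
    {C α : ℝ} (hC : 0 ≤ C) (h0 : 0 < α) (h1 : α ≤ 1)
    (hcov : ∀ k l : ℕ, 1 ≤ k → k ≤ l → ∫ ω, inner ℝ (Y k ω) (Y l ω) ∂μ ≤ C * ((k : ℝ) / l) ^ α) :
    ∀ᵐ ω ∂μ, Tendsto (fun n => (asW n)⁻¹ • ∑ k ∈ Finset.Icc 1 n, (k : ℝ)⁻¹ • Y k ω)
      atTop (𝓝 0) := by
  classical
  set T : ℕ → Ω → ℂ := fun n ω => ∑ k ∈ Finset.Icc 1 n, (k : ℝ)⁻¹ • Y k ω with hT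
  have hTm : ∀ n, Measurable (T n) := fun n => by
    simp only [hT]; fun_prop
  have hdiff : ∀ m n ω, m ≤ n → ‖T n ω - T m ω‖ ≤ 2 * (asW n - asW m) := by
    intro m n ω hmn
    induction n, hmn using Nat.le_induction with
    | base => simp
    | succ n hn ih =>
      have e : T (n + 1) ω = T n ω + ((n + 1 : ℕ) : ℝ)⁻¹ • Y (n + 1) ω := by
        simp only [hT]; rw [Finset.sum_Icc_succ_top (by omega)]
      rw [e, asW_succ, add_sub_right_comm]
      refine (norm_add_le _ _).trans ?_
      rw [norm_smul, Real.norm_of_nonneg (by positivity)]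
      have := mul_le_mul_of_nonneg_left (hb (n + 1) ω)
        (by positivity : (0 : ℝ) ≤ ((n + 1 : ℕ) : ℝ)⁻¹)
      linarith
  have hTb : ∀ n ω, ‖T n ω‖ ≤ 2 * asW n := fun n ω => by
    have := hdiff 0 n ω (Nat.zero_le _)
    simpa [hT, asW] using this
  have hW0 : ∀ n, 0 ≤ asW n := fun n => by unfold asW; positivity
  let m : ℕ → ℕ := fun j => Nat.find (as_exists j)
  have hmW : ∀ j : ℕ, ((j : ℝ) + 1) ^ 2 ≤ asW (m j) := fun j => Nat.find_spec (as_exists j)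
  have hmle : ∀ (j n : ℕ), ((j : ℝ) + 1) ^ 2 ≤ asW n → m j ≤ n := fun j n h => Nat.find_min' _ h
  -- convergence along the subsequence
  have hsub : ∀ᵐ ω ∂μ, Tendsto (fun j => ‖(asW (m j))⁻¹ • T (m j) ω‖ ^ 2) atTop (𝓝 0) := by
    have hSm : ∀ j, Measurable (fun ω => ‖(asW (m j))⁻¹ • T (m j) ω‖ ^ 2) := fun j =>
      by have := hTm (m j); fun_prop
    have hbd : ∀ j : ℕ, ∫⁻ ω, ENNReal.ofReal (‖(asW (m j))⁻¹ • T (m j) ω‖ ^ 2) ∂μ ≤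
        ENNReal.ofReal (2 * C / α * (1 / ((j + 1 : ℕ) : ℝ) ^ 2)) := by
      intro j
      have hWp : 0 < asW (m j) := lt_of_lt_of_le (by positivity) (hmW j)
      rw [← ofReal_integral_eq_lintegral_ofReal]
      · apply ENNReal.ofReal_le_ofReal
        have h2 := as_second_moment μ Y hm hb hC h0 h1 hcov (m j)
        simp_rw [norm_smul, mul_pow]
        rw [integral_const_mul, Real.norm_of_nonneg (by positivity)]
        calc _ ≤ ((asW (m j))⁻¹) ^ 2 * (2 * C / α * asW (m j)) := by gcongr
          _ = 2 * C / α * (1 / asW (m j)) := by field_simp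
          _ ≤ _ := by
            have := hmW j
            push_cast
            gcongr
      · refine Integrable.of_bound (C := (2 : ℝ) ^ 2) (hSm j).aestronglyMeasurable
          (ae_of_all _ fun ω => ?_)
        rw [norm_pow, norm_norm]
        gcongr
        rw [norm_smul, Real.norm_of_nonneg (by positivity), inv_mul_le_iff₀ hWp, mul_comm]
        exact hTb _ _
      · exact ae_of_all _ fun ω => by positivity
    have hsum : ∑' j : ℕ, ENNReal.ofReal (2 * C / α * (1 / ((j + 1 : ℕ) : ℝ) ^ 2)) ≠ ⊤ := by
      refine Summable.tsum_ofReal_ne_top ?_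
      refine Summable.mul_left _ ?_
      exact (summable_nat_add_iff 1).2 (Real.summable_one_div_nat_pow.2 one_lt_two)
    have hlt : ∫⁻ ω, ∑' j : ℕ, ENNReal.ofReal (‖(asW (m j))⁻¹ • T (m j) ω‖ ^ 2) ∂μ ≠ ⊤ := by
      rw [lintegral_tsum fun j => (hSm j).ennreal_ofReal.aemeasurable]
      exact ne_top_of_le_ne_top hsum (ENNReal.tsum_le_tsum hbd)
    filter_upwards [ae_lt_top (Measurable.tsum fun j => (hSm j).ennreal_ofReal) hlt]
      with ω hω
    have h3 := ENNReal.tendsto_atTop_zero_of_tsum_ne_top hω.ne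
    have h4 := (ENNReal.tendsto_toReal ENNReal.zero_ne_top).comp h3
    refine h4.congr fun j => ?_
    exact ENNReal.toReal_ofReal (by positivity)
  filter_upwards [hsub] with ω hω
  have hω2 : Tendsto (fun j => ‖(asW (m j))⁻¹ • T (m j) ω‖) atTop (𝓝 0) := by
    have := hω.sqrt
    rw [Real.sqrt_zero] at this
    exact this.congr fun j => Real.sqrt_sq (norm_nonneg _)
  -- interpolation
  let J : ℕ → ℕ := fun n => ⌊√(asW n)⌋₊ - 1
  have hJ : Tendsto J atTop atTop :=
    (tendsto_sub_atTop_nat 1).comp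
      (tendsto_nat_floor_atTop.comp (Real.tendsto_sqrt_atTop.comp asW_tendsto))
  have hlim : Tendsto (fun j : ℕ => ‖(asW (m j))⁻¹ • T (m j) ω‖ + 6 * (1 / ((j : ℝ) + 1)))
      atTop (𝓝 0) := by
    simpa using hω2.add (tendsto_one_div_add_atTop_nhds_zero_nat.const_mul (6 : ℝ))
  rw [tendsto_zero_iff_norm_tendsto_zero]
  refine squeeze_zero' (Eventually.of_forall fun n => norm_nonneg _) ?_ (hlim.comp hJ)
  filter_upwards [asW_tendsto.eventually_ge_atTop 1] with n hn
  have hs1 : 1 ≤ √(asW n) := Real.one_le_sqrt.2 hn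
  have hf1 : 1 ≤ ⌊√(asW n)⌋₊ := Nat.le_floor (by simpa using hs1)
  have hJ1 : ((J n : ℝ) + 1) = (⌊√(asW n)⌋₊ : ℝ) := by
    have : J n + 1 = ⌊√(asW n)⌋₊ := by simp only [J]; omega
    exact_mod_cast this
  have hlo : ((J n : ℝ) + 1) ^ 2 ≤ asW n := by
    rw [hJ1, ← Real.sq_sqrt (hW0 n)]
    gcongr
    rw [Real.sq_sqrt (hW0 n)]
    exact Nat.floor_le (by positivity)
  have hhi : asW n ≤ ((J n : ℝ) + 2) ^ 2 := by
    rw [← Real.sq_sqrt (hW0 n)]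
    gcongr
    have := (Nat.lt_floor_add_one (√(asW n))).le
    linarith
  have hmn := hmle _ _ hlo
  have hM := hmW (J n)
  have hd := hdiff _ _ ω hmn
  have hWm := asW_mono hmn
  set j : ℝ := (J n : ℝ) with hj
  have hj0 : 0 ≤ j := by positivity
  have hWn : 0 < asW n := by linarith
  have hWmp : 0 < asW (m (J n)) := lt_of_lt_of_le (by positivity) hM
  simp only [Function.comp]
  rw [norm_smul, norm_smul, Real.norm_of_nonneg (by positivity), Real.norm_of_nonneg (by positivity)]
  have htri : ‖T n ω‖ ≤ ‖T (m (J n)) ω‖ + 2 * (asW n - asW (m (J n))) := by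
    have := norm_add_le (T (m (J n)) ω) (T n ω - T (m (J n)) ω)
    rw [add_sub_cancel] at this
    linarith
  calc (asW n)⁻¹ * ‖T n ω‖ ≤ (asW n)⁻¹ * (‖T (m (J n)) ω‖ + 2 * (2 * j + 3)) := by
        gcongr
        nlinarith
    _ = (asW n)⁻¹ * ‖T (m (J n)) ω‖ + (asW n)⁻¹ * (2 * (2 * j + 3)) := by ring
    _ ≤ (asW (m (J n)))⁻¹ * ‖T (m (J n)) ω‖ + ((j + 1) ^ 2)⁻¹ * (6 * (j + 1)) := by
        refine add_le_add (by gcongr) (mul_le_mul (by gcongr) (by linarith) (by positivity)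
          (by positivity))
    _ = _ := by rw [← hj]; field_simp
end slln

lemma as_rho_bound {H : ℝ} (h0 : 0 < H) (h1 : H < 1) {k l : ℕ} (hk : 1 ≤ k) (hkl : k ≤ l) :
    ((k : ℝ) ^ H)⁻¹ * ((l : ℝ) ^ H)⁻¹ * ((1 / 2 : ℝ) * ((k : ℝ) ^ (2 * H) + (l : ℝ) ^ (2 * H) -
      |(k : ℝ) - (l : ℝ)| ^ (2 * H))) ≤ 3 / 2 * ((k : ℝ) / l) ^ (min H (1 - H)) := by
  have hkp : (0 : ℝ) < k := by exact_mod_cast hk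
  have hlp : (0 : ℝ) < l := by exact_mod_cast hk.trans hkl
  set r : ℝ := (k : ℝ) / l with hr
  have hrp : 0 < r := by positivity
  have hr1 : r ≤ 1 := by rw [hr, div_le_one hlp]; exact_mod_cast hkl
  have hkr : (k : ℝ) = r * l := by rw [hr]; field_simp
  have hab : |(k : ℝ) - l| = (1 - r) * l := by
    rw [abs_sub_comm, abs_of_nonneg (sub_nonneg.2 (by exact_mod_cast hkl)), hkr]; ring
  have hL : (l : ℝ) ^ (2 * H) = (l : ℝ) ^ H * (l : ℝ) ^ H := by
    rw [← Real.rpow_add hlp]; ring_nf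
  have hR : r ^ (2 * H) = r ^ H * r ^ H := by
    rw [← Real.rpow_add hrp]; ring_nf
  have hB : 1 - 2 * r ≤ (1 - r) ^ (2 * H) := by
    rcases eq_or_lt_of_le hr1 with h | h
    · have : 0 ≤ (1 - r) ^ (2 * H) := Real.rpow_nonneg (by linarith) _
      linarith
    · have : (1 - r) ^ (2 : ℝ) ≤ (1 - r) ^ (2 * H) :=
        Real.rpow_le_rpow_of_exponent_ge (by linarith) (by linarith) (by linarith)
      rw [Real.rpow_two] at this
      nlinarith
  have hrH : r = r ^ H * r ^ (1 - H) := by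
    rw [← Real.rpow_add hrp]; simp
  have hm1 : r ^ H ≤ r ^ (min H (1 - H)) :=
    Real.rpow_le_rpow_of_exponent_ge hrp hr1 (min_le_left _ _)
  have hm2 : r ^ (1 - H) ≤ r ^ (min H (1 - H)) :=
    Real.rpow_le_rpow_of_exponent_ge hrp hr1 (min_le_right _ _)
  rw [hab, Real.mul_rpow (by linarith) hlp.le, hkr, Real.mul_rpow hrp.le hlp.le,
    Real.mul_rpow hrp.le hlp.le, hL, hR]
  have hlH : 0 < (l : ℝ) ^ H := by positivity
  have hrHp : 0 < r ^ H := by positivity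
  calc _ = 1 / 2 * ((r ^ H)⁻¹ * (r ^ H * r ^ H + (1 - (1 - r) ^ (2 * H)))) := by
        field_simp
        ring
    _ ≤ 1 / 2 * ((r ^ H)⁻¹ * (r ^ H * r ^ H + 2 * (r ^ H * r ^ (1 - H)))) := by
        rw [← hrH]
        gcongr
        linarith
    _ = 1 / 2 * (r ^ H + 2 * r ^ (1 - H)) := by field_simp
    _ ≤ _ := by linarith

section cov
variable {Ω : Type*} {mΩ : MeasurableSpace Ω} {μ : Measure Ω} [IsProbabilityMeasure μ]

lemma as_gauss_cos {Z : Ω → ℝ} (hZ : Measurable Z) {v : NNReal}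
    (h : Measure.map Z μ = gaussianReal 0 v) (t : ℝ) :
    ∫ ω, Real.cos (t * Z ω) ∂μ = Real.exp (-(v * t ^ 2 / 2)) := by
  have h1 := charFun_gaussianReal (μ := 0) (v := v) t
  rw [← h, charFun_apply_real, integral_map hZ.aemeasurable (by fun_prop)] at h1
  have hint : Integrable (fun ω => Complex.exp (t * Z ω * Complex.I)) μ := by
    refine Integrable.of_bound (C := 1) (by fun_prop) (ae_of_all _ fun ω => ?_)
    rw [← Complex.ofReal_mul, Complex.norm_exp_ofReal_mul_I]
  have h2 := congrArg Complex.re h1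
  rw [← RCLike.re_eq_complex_re, ← integral_re hint] at h2
  simp only [RCLike.re_eq_complex_re] at h2
  have h3 : ∀ ω, (Complex.exp (t * Z ω * Complex.I)).re = Real.cos (t * Z ω) := fun ω => by
    rw [← Complex.ofReal_mul, Complex.exp_ofReal_mul_I_re]
  simp_rw [h3] at h2
  rw [h2]
  have : (t * (0 : ℝ) * Complex.I - v * t ^ 2 / 2 : ℂ) = ((-(v * t ^ 2 / 2) : ℝ) : ℂ) := by
    push_cast; ring
  rw [this, Complex.exp_ofReal_re]

lemma as_gauss_sq {Z : Ω → ℝ} (hZ : Measurable Z) {v : NNReal}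
    (h : Measure.map Z μ = gaussianReal 0 v) : ∫ ω, Z ω ^ 2 ∂μ = v := by
  have h1 := variance_fun_id_gaussianReal (μ := 0) (v := v)
  rw [variance_of_integral_eq_zero (by fun_prop) (by simp)] at h1
  rw [← h, integral_map hZ.aemeasurable (by fun_prop)] at h1
  exact h1

lemma as_gauss_memLp {Z : Ω → ℝ} (hZ : Measurable Z) {v : NNReal}
    (h : Measure.map Z μ = gaussianReal 0 v) : MemLp Z 2 μ := by
  have h1 := memLp_id_gaussianReal (μ := 0) (v := v) 2
  rw [← h, memLp_map_measure_iff (by fun_prop) hZ.aemeasurable] at h1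
  exact h1

lemma as_cov
    (H : ℝ) (hH : H ∈ Set.Ioo (0 : ℝ) 1)
    (B : ℕ → Ω → ℝ) (hBmeas : ∀ k, Measurable (B k))
    (hGauss : ∀ (s : Finset ℕ) (a : ℕ → ℝ), ∃ v : NNReal,
      Measure.map (fun ω => ∑ i ∈ s, a i * B i ω) μ = gaussianReal 0 v)
    (hcov : ∀ k l : ℕ, ∫ ω, B k ω * B l ω ∂μ =
      (1 / 2 : ℝ) * ((k : ℝ) ^ (2 * H) + (l : ℝ) ^ (2 * H) - |(k : ℝ) - (l : ℝ)| ^ (2 * H)))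
    (t : ℝ) (k l : ℕ) (hk : 1 ≤ k) (hkl : k ≤ l) :
    ∫ ω, inner ℝ (Complex.exp (t * (B k ω / (k : ℝ) ^ H : ℝ) * Complex.I) - Real.exp (-(t ^ 2 / 2)))
      (Complex.exp (t * (B l ω / (l : ℝ) ^ H : ℝ) * Complex.I) - Real.exp (-(t ^ 2 / 2))) ∂μ ≤
      (t ^ 2 * (3 / 2)) * ((k : ℝ) / l) ^ (min H (1 - H)) := by
  have hkp : (0 : ℝ) < k := by exact_mod_cast hk
  have hlp : (0 : ℝ) < l := by exact_mod_cast hk.trans hkl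
  have hkH : (0 : ℝ) < (k : ℝ) ^ H := by positivity
  have hlH : (0 : ℝ) < (l : ℝ) ^ H := by positivity
  have hG2 : ∀ x y : ℝ, ∀ i j : ℕ, ∃ v : NNReal,
      Measure.map (fun ω => x * B i ω + y * B j ω) μ = gaussianReal 0 v := by
    intro x y i j
    obtain ⟨v, hv⟩ := hGauss {i, j} (fun n => (if n = i then x else 0) + (if n = j then y else 0))
    refine ⟨v, ?_⟩
    rw [← hv]
    congr 1
    ext ω
    simp_rw [add_mul, Finset.sum_add_distrib, ite_mul, zero_mul, Finset.sum_ite_eq']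
    simp
  have hLp : ∀ i, MemLp (B i) 2 μ := fun i => by
    obtain ⟨v, hv⟩ := hG2 1 0 i i
    simp only [one_mul, zero_mul, add_zero] at hv
    exact as_gauss_memLp (hBmeas i) hv
  have hii : ∀ i j, Integrable (fun ω => B i ω * B j ω) μ := fun i j =>
    (hLp i).integrable_mul (hLp j)
  have hvar : ∀ x y : ℝ, ∀ i j : ℕ, ∫ ω, (x * B i ω + y * B j ω) ^ 2 ∂μ =
      x ^ 2 * (∫ ω, B i ω * B i ω ∂μ) + 2 * (x * y) * (∫ ω, B i ω * B j ω ∂μ)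
        + y ^ 2 * (∫ ω, B j ω * B j ω ∂μ) := by
    intro x y i j
    rw [← integral_const_mul, ← integral_const_mul, ← integral_const_mul, ← integral_add
      ((hii i i).const_mul _) ((hii i j).const_mul _), ← integral_add _ ((hii j j).const_mul _)]
    · congr with ω; ring
    · exact ((hii i i).const_mul _).add ((hii i j).const_mul _)
  have hself : ∀ i : ℕ, ∫ ω, B i ω * B i ω ∂μ = (i : ℝ) ^ H * (i : ℝ) ^ H := fun i => by
    rw [hcov, sub_self, abs_zero, Real.zero_rpow (by linarith [hH.1]), two_mul H]
    rw [Real.rpow_add_of_nonneg (by positivity) hH.1.le hH.1.le]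
    ring
  have hcos : ∀ x y : ℝ, ∀ i j : ℕ, ∫ ω, Real.cos (t * (x * B i ω + y * B j ω)) ∂μ =
      Real.exp (-((∫ ω, (x * B i ω + y * B j ω) ^ 2 ∂μ) * t ^ 2 / 2)) := by
    intro x y i j
    obtain ⟨v, hv⟩ := hG2 x y i j
    have hme : Measurable (fun ω => x * B i ω + y * B j ω) := by
      have := hBmeas i; have := hBmeas j; fun_prop
    rw [as_gauss_cos hme hv, as_gauss_sq hme hv]
  set c := Real.exp (-(t ^ 2 / 2)) with hc
  have hone : ∀ i : ℕ, 1 ≤ i → ∫ ω, Real.cos (t * (B i ω / (i : ℝ) ^ H)) ∂μ = c := by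
    intro i hi
    have hip : (0 : ℝ) < i := by exact_mod_cast hi
    have hiH : (0 : ℝ) < (i : ℝ) ^ H := by positivity
    have h := hcos ((i : ℝ) ^ H)⁻¹ 0 i i
    rw [hvar, hself] at h
    have e : ∀ ω, ((i : ℝ) ^ H)⁻¹ * B i ω + 0 * B i ω = B i ω / (i : ℝ) ^ H := fun ω => by
      rw [div_eq_inv_mul]; ring
    simp_rw [e] at h
    rw [h, hc]
    congr 1
    field_simp
    ring
  set ρ := ((k : ℝ) ^ H)⁻¹ * ((l : ℝ) ^ H)⁻¹ * ((1 / 2 : ℝ) * ((k : ℝ) ^ (2 * H) +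
    (l : ℝ) ^ (2 * H) - |(k : ℝ) - (l : ℝ)| ^ (2 * H))) with hρ
  have hρb : ρ ≤ 3 / 2 * ((k : ℝ) / l) ^ (min H (1 - H)) := as_rho_bound hH.1 hH.2 hk hkl
  have hv : ∫ ω, (((k : ℝ) ^ H)⁻¹ * B k ω + -((l : ℝ) ^ H)⁻¹ * B l ω) ^ 2 ∂μ = 2 - 2 * ρ := by
    rw [hvar, hself, hself, hcov, hρ]
    field_simp
    ring
  have hv0 : 0 ≤ 2 - 2 * ρ := by
    rw [← hv]; exact integral_nonneg fun ω => by positivity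
  have hdiff := hcos ((k : ℝ) ^ H)⁻¹ (-((l : ℝ) ^ H)⁻¹) k l
  rw [hv] at hdiff
  have e : ∀ ω, ((k : ℝ) ^ H)⁻¹ * B k ω + -((l : ℝ) ^ H)⁻¹ * B l ω =
      B k ω / (k : ℝ) ^ H - B l ω / (l : ℝ) ^ H := fun ω => by
    rw [div_eq_inv_mul, div_eq_inv_mul]; ring
  simp_rw [e] at hdiff
  have hin : ∀ x y : ℝ, inner ℝ (Complex.exp (t * (x : ℝ) * Complex.I) - c)
      (Complex.exp (t * (y : ℝ) * Complex.I) - c) =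
      Real.cos (t * (x - y)) - c * Real.cos (t * x) - c * Real.cos (t * y) + c ^ 2 := by
    intro x y
    rw [Complex.inner, ← Complex.ofReal_mul, ← Complex.ofReal_mul, mul_sub, Real.cos_sub]
    simp only [map_sub, Complex.conj_ofReal, Complex.mul_re, Complex.sub_re, Complex.sub_im,
      Complex.conj_re, Complex.conj_im, Complex.exp_ofReal_mul_I_re, Complex.exp_ofReal_mul_I_im,
      Complex.ofReal_re, Complex.ofReal_im]
    ring
  simp_rw [hin]
  have hci : ∀ {Z : Ω → ℝ}, Measurable Z → Integrable (fun ω => Real.cos (t * Z ω)) μ := by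
    intro Z hZ
    refine Integrable.of_bound (C := 1) (by fun_prop) (ae_of_all _ fun ω => ?_)
    exact Real.abs_cos_le_one _
  have mk := (hBmeas k).div_const ((k : ℝ) ^ H)
  have ml := (hBmeas l).div_const ((l : ℝ) ^ H)
  have i1 : Integrable (fun ω => Real.cos (t * (B k ω / (k : ℝ) ^ H - B l ω / (l : ℝ) ^ H))) μ :=
    hci (mk.sub ml)
  have i2 := (hci mk).const_mul c
  have i3 := (hci ml).const_mul c
  have i12 : Integrable (fun ω => Real.cos (t * (B k ω / (k : ℝ) ^ H - B l ω / (l : ℝ) ^ H)) -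
      c * Real.cos (t * (B k ω / (k : ℝ) ^ H))) μ := i1.sub i2
  have i123 : Integrable (fun ω => Real.cos (t * (B k ω / (k : ℝ) ^ H - B l ω / (l : ℝ) ^ H)) -
      c * Real.cos (t * (B k ω / (k : ℝ) ^ H)) - c * Real.cos (t * (B l ω / (l : ℝ) ^ H))) μ :=
    i12.sub i3
  have key : ∫ ω, (Real.cos (t * (B k ω / (k : ℝ) ^ H - B l ω / (l : ℝ) ^ H)) -
      c * Real.cos (t * (B k ω / (k : ℝ) ^ H)) - c * Real.cos (t * (B l ω / (l : ℝ) ^ H)) + c ^ 2) ∂μ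
      = Real.exp (-((2 - 2 * ρ) * t ^ 2 / 2)) - c * c - c * c + c ^ 2 := by
    rw [integral_add i123 (integrable_const _)]
    rw [integral_sub i12 i3]
    rw [integral_sub i1 i2]
    rw [integral_const_mul, integral_const_mul, hone k hk, hone l (hk.trans hkl), integral_const]
    rw [hdiff]
    simp
  rw [key]
  have hcc : c ^ 2 = Real.exp (-((2 - 2 * ρ) * t ^ 2 / 2)) * Real.exp (-(t ^ 2 * ρ)) := by
    rw [hc, ← Real.exp_nat_mul, ← Real.exp_add]
    congr 1
    push_cast
    ring
  set E := Real.exp (-((2 - 2 * ρ) * t ^ 2 / 2)) with hE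
  have hE0 : 0 < E := Real.exp_pos _
  have hE1 : E ≤ 1 := by
    rw [hE, Real.exp_le_one_iff]
    have : 0 ≤ (2 - 2 * ρ) * t ^ 2 / 2 := by positivity
    linarith
  have hx := Real.add_one_le_exp (-(t ^ 2 * ρ))
  have hM : 1 - Real.exp (-(t ^ 2 * ρ)) ≤ t ^ 2 * (3 / 2) * ((k : ℝ) / l) ^ (min H (1 - H)) := by
    have := mul_le_mul_of_nonneg_left hρb (sq_nonneg t)
    linarith
  have hM0 : 0 ≤ t ^ 2 * (3 / 2) * ((k : ℝ) / l) ^ (min H (1 - H)) := by positivity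
  calc E - c * c - c * c + c ^ 2 = E * (1 - Real.exp (-(t ^ 2 * ρ))) := by linear_combination -hcc
    _ ≤ E * (t ^ 2 * (3 / 2) * ((k : ℝ) / l) ^ (min H (1 - H))) := by gcongr
    _ ≤ 1 * (t ^ 2 * (3 / 2) * ((k : ℝ) / l) ^ (min H (1 - H))) := by gcongr
    _ = _ := one_mul _
end cov

/-- the log-averaged empirical measure -/
noncomputable def asNu (x : ℕ → ℝ) (n : ℕ) : Measure ℝ :=
  ∑ k ∈ Finset.Icc 1 (n + 1), ENNReal.ofReal ((asW (n + 1))⁻¹ * (k : ℝ)⁻¹) • Measure.dirac (x k)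

instance asNu_prob (x : ℕ → ℝ) (n : ℕ) : IsProbabilityMeasure (asNu x n) := by
  have hW : 0 < asW (n + 1) := asW_pos (by omega)
  constructor
  simp only [asNu, Measure.coe_finsetSum, Finset.sum_apply, Measure.smul_apply, measure_univ,
    smul_eq_mul, mul_one]
  rw [← ENNReal.ofReal_sum_of_nonneg fun k _ => by positivity, ← Finset.mul_sum]
  change ENNReal.ofReal ((asW (n + 1))⁻¹ * asW (n + 1)) = 1
  rw [inv_mul_cancel₀ hW.ne', ENNReal.ofReal_one]

lemma asNu_integral {E : Type*} [NormedAddCommGroup E] [NormedSpace ℝ E] [CompleteSpace E]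
    (x : ℕ → ℝ) (n : ℕ) (f : ℝ → E) :
    ∫ y, f y ∂(asNu x n) =
      (asW (n + 1))⁻¹ • ∑ k ∈ Finset.Icc 1 (n + 1), (k : ℝ)⁻¹ • f (x k) := by
  have hW : 0 < asW (n + 1) := asW_pos (by omega)
  unfold asNu
  rw [integral_finsetSum_measure]
  · rw [Finset.smul_sum]
    refine Finset.sum_congr rfl fun k _ => ?_
    rw [integral_smul_measure, integral_dirac, ENNReal.toReal_ofReal (by positivity), smul_smul]
  · intro k _
    exact (integrable_dirac (by simp)).smul_measure ENNReal.ofReal_ne_top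

theorem stmt4
    {Ω : Type*} {mΩ : MeasurableSpace Ω} (μ : Measure Ω) [IsProbabilityMeasure μ]
    (H : ℝ) (hH : H ∈ Set.Ioo (0 : ℝ) 1)
    (B : ℕ → Ω → ℝ) (hBmeas : ∀ k, Measurable (B k))
    -- every finite real-linear combination of the `B_k` is centered Gaussian
    (hGauss : ∀ (s : Finset ℕ) (a : ℕ → ℝ), ∃ v : NNReal,
      Measure.map (fun ω => ∑ i ∈ s, a i * B i ω) μ = gaussianReal 0 v)
    -- fBm covariance structure
    (hcov : ∀ k l : ℕ, ∫ ω, B k ω * B l ω ∂μ =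
      (1 / 2 : ℝ) * ((k : ℝ) ^ (2 * H) + (l : ℝ) ^ (2 * H) - |(k : ℝ) - (l : ℝ)| ^ (2 * H))) :
    -- ASCLT for `G_k = B_k / k^H`
    ∀ᵐ ω ∂μ, ∀ φ : BoundedContinuousFunction ℝ ℝ,
      Tendsto (fun n : ℕ => (Real.log n)⁻¹ *
          ∑ k ∈ Finset.Icc 1 n, (k : ℝ)⁻¹ * φ (B k ω / (k : ℝ) ^ H))
        atTop (𝓝 (∫ x, φ x ∂(gaussianReal 0 1))) := by
  have hα0 : 0 < min H (1 - H) := lt_min hH.1 (by linarith [hH.2])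
  have hα1 : min H (1 - H) ≤ 1 := (min_le_left _ _).trans hH.2.le
  let P : ℝ → Ω → Prop := fun t ω => Tendsto (fun n : ℕ => (asW n)⁻¹ • ∑ k ∈ Finset.Icc 1 n,
    (k : ℝ)⁻¹ • (Complex.exp (t * (B k ω / (k : ℝ) ^ H : ℝ) * Complex.I) -
      Real.exp (-(t ^ 2 / 2)))) atTop (𝓝 0)
  have hPt : ∀ t, ∀ᵐ ω ∂μ, P t ω := by
    intro t
    refine as_slln μ (fun k ω => Complex.exp (t * (B k ω / (k : ℝ) ^ H : ℝ) * Complex.I) -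
      Real.exp (-(t ^ 2 / 2))) ?_ ?_ (by positivity : (0 : ℝ) ≤ t ^ 2 * (3 / 2)) hα0 hα1
      (as_cov H hH B hBmeas hGauss hcov t)
    · intro k
      have := hBmeas k
      fun_prop
    · intro k ω
      refine (norm_sub_le _ _).trans ?_
      rw [← Complex.ofReal_mul, Complex.norm_exp_ofReal_mul_I, Complex.norm_real,
        Real.norm_of_nonneg (Real.exp_pos _).le]
      have : Real.exp (-(t ^ 2 / 2)) ≤ 1 := by
        rw [Real.exp_le_one_iff]; have := sq_nonneg t; linarith
      linarith
  have hPm : MeasurableSet {x : ℝ × Ω | P x.1 x.2} := by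
    refine measurableSet_tendsto (𝓝 0) fun n => ?_
    fun_prop
  have hae : ∀ᵐ ω ∂μ, ∀ᵐ t : ℝ, P t ω :=
    (Measure.ae_ae_comm (μ := (volume : Measure ℝ)) (ν := μ) (p := P) hPm).1 (ae_of_all _ hPt)
  filter_upwards [hae] with ω hω φ
  set x : ℕ → ℝ := fun k => B k ω / (k : ℝ) ^ H with hx
  let ν : ℕ → ProbabilityMeasure ℝ := fun n => ⟨asNu x n, asNu_prob x n⟩
  let γ : ProbabilityMeasure ℝ := ⟨gaussianReal 0 1, inferInstance⟩
  have hlevy : Tendsto ν atTop (𝓝 γ) := by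
    refine aslt_levy ?_
    filter_upwards [hω] with t ht
    change Tendsto (fun n => charFun (asNu x n) t) atTop (𝓝 (charFun (gaussianReal 0 1) t))
    have hg : charFun (gaussianReal 0 1) t = ((Real.exp (-(t ^ 2 / 2)) : ℝ) : ℂ) := by
      rw [charFun_gaussianReal]
      push_cast
      congr 1
      simp
    rw [hg, ← tendsto_sub_nhds_zero_iff]
    refine (ht.comp (tendsto_add_atTop_nat 1)).congr fun n => ?_
    have hW : 0 < asW (n + 1) := asW_pos (by omega)
    simp only [Function.comp]
    rw [charFun_apply_real, asNu_integral]
    simp_rw [smul_sub]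
    rw [Finset.sum_sub_distrib, smul_sub, ← Finset.sum_smul]
    change _ - (asW (n + 1))⁻¹ • asW (n + 1) • _ = _
    rw [smul_smul, inv_mul_cancel₀ hW.ne', one_smul]
  have h1 := (ProbabilityMeasure.tendsto_iff_forall_integral_tendsto.1 hlevy) φ
  change Tendsto (fun n => ∫ y, φ y ∂(asNu x n)) atTop (𝓝 (∫ y, φ y ∂(gaussianReal 0 1))) at h1
  simp only [asNu_integral, smul_eq_mul] at h1
  have h2 := (tendsto_add_atTop_iff_nat
    (f := fun n => (asW n)⁻¹ * ∑ k ∈ Finset.Icc 1 n, (k : ℝ)⁻¹ * φ (x k)) 1).1 h1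
  have h3 := asW_div_log.mul h2
  rw [one_mul] at h3
  refine h3.congr' ?_
  filter_upwards [eventually_ge_atTop 1] with n hn
  have hW := asW_pos hn
  rw [mul_assoc, mul_inv_cancel_left₀ hW.ne']
end
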